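/- Let k be a field, T = k((X))[[Y,Z]] the formal power series ring in Y, Z over the Laurent series field k((X)), M = (Y,Z)T its maximal ideal, and R = k[[X]] + M. Then R has the finite v-basic ideal property (every nonzero finitely generated ideal of R is v-basic), but R is not a v-domain: the finitely generated ideal (Y,Z)R satisfies ((Y,Z)R · ((Y,Z)R)⁻¹)_v = M ≠ R. -/

import Mathlib

set_option synthInstance.maxHeartbeats 1000000
set_option maxHeartbeats 2000000

noncomputable section

variable (k : Type*) [Field k]

/-- `T = k((X))[[Y,Z]]`, the power series ring in two indeterminates `Y, Z` over the
Laurent series field `k((X))`. -/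
abbrev Tk := MvPowerSeries (Fin 2) (LaurentSeries k)

instance : IsDomain (Tk k) := NoZeroDivisors.to_isDomain _

/-- The subring `R = k[[X]] + M` of `T` (where `M = (Y,Z)T`): power series whose constant
term (a Laurent series in `X`) lies in `k[[X]]`. -/
def subR : Subring (Tk k) :=
  Subring.comap (MvPowerSeries.constantCoeff (σ := Fin 2) (R := LaurentSeries k))
    (algebraMap (PowerSeries k) (LaurentSeries k)).range

/-- The quotient field `K` of `R` (which is also the quotient field of `T`). -/
abbrev FieldK := FractionRing (Tk k)

instance (priority := 10000) : Module (subR k) (FieldK k) := Algebra.toModule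

/-- `Y` as an element of `R`. -/
def yR : subR k :=
  ⟨MvPowerSeries.X 0, by
    rw [subR, Subring.mem_comap, MvPowerSeries.constantCoeff_X]
    exact ⟨0, map_zero _⟩⟩

/-- `Z` as an element of `R`. -/
def zR : subR k :=
  ⟨MvPowerSeries.X 1, by
    rw [subR, Subring.mem_comap, MvPowerSeries.constantCoeff_X]
    exact ⟨0, map_zero _⟩⟩

/-- The maximal ideal `M = (Y,Z)T` of `T`, viewed as an ideal of `R = k[[X]] + M`
(the kernel of the constant-term map on `R`). -/
def idealMR : Ideal (subR k) :=
  RingHom.ker ((MvPowerSeries.constantCoeff (σ := Fin 2) (R := LaurentSeries k)).comp (subR k).subtype)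

/-- An ideal of `R` regarded as an `R`-submodule of the quotient field `K`. -/
def idl (I : Ideal (subR k)) : Submodule (subR k) (FieldK k) :=
  Submodule.map (Algebra.linearMap (subR k) (FieldK k)) I

/-- The `v`-operation on fractional `R`-ideals (as `R`-submodules of `K`):
`A_v = (A⁻¹)⁻¹ = 1/(1/A)`. -/
def vSub (A : Submodule (subR k) (FieldK k)) : Submodule (subR k) (FieldK k) :=
  (1 : Submodule (subR k) (FieldK k)) / ((1 : Submodule (subR k) (FieldK k)) / A)

section HahnPart

open HahnSeries

/-- exponent embedding -/
def eAux : (Fin 2 →₀ ℕ) →+ (ℤ ×ₗ ℤ) where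
  toFun m := toLex ((m 0 : ℤ), (m 1 : ℤ))
  map_zero' := rfl
  map_add' a b := by
    apply (ofLex).injective
    ext <;> simp

lemma eAux_fst (m) : (ofLex (eAux m)).1 = (m 0 : ℤ) := rfl

lemma eAux_snd (m) : (ofLex (eAux m)).2 = (m 1 : ℤ) := rfl

lemma eAux_inj : Function.Injective eAux := by
  intro a b h
  have h1 := congrArg (fun x => (ofLex x).1) h
  have h2 := congrArg (fun x => (ofLex x).2) h
  simp only [eAux_fst, eAux_snd, Nat.cast_inj] at h1 h2
  ext i
  fin_cases i
  · exact h1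
  · exact h2

lemma eAux_mono : Monotone eAux := by
  intro a b h
  have h0 := h 0
  have h1 := h 1
  apply Prod.Lex.toLex_mono
  exact ⟨Int.ofNat_le.mpr h0, Int.ofNat_le.mpr h1⟩

lemma eAux_range {g : ℤ ×ₗ ℤ} (h0 : 0 ≤ (ofLex g).1) (h1 : 0 ≤ (ofLex g).2) :
    g ∈ Set.range eAux := by
  refine ⟨Finsupp.single 0 (ofLex g).1.toNat + Finsupp.single 1 (ofLex g).2.toNat, ?_⟩
  apply (ofLex).injective
  ext
  · rw [eAux_fst]; simp [h0]
  · rw [eAux_snd]; simp [h1]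

lemma eAux_pwo : (Set.range eAux).IsPWO := by
  rw [← Set.image_univ]
  apply Set.IsPWO.image_of_monotone _ eAux_mono
  exact Set.isPWO_of_wellQuasiOrderedLE _

variable {F : Type*} [Field F]

/-- the embedding as a function -/
def phiFun (f : MvPowerSeries (Fin 2) F) : HahnSeries (ℤ ×ₗ ℤ) F where
  coeff := Function.extend eAux (fun m => MvPowerSeries.coeff m f) 0
  isPWO_support' := eAux_pwo.mono (by
    intro g hg
    by_contra h
    apply hg
    rw [Function.extend_apply' _ _ _ h]; rfl)

lemma phiFun_coeff (f : MvPowerSeries (Fin 2) F) (m) :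
    (phiFun f).coeff (eAux m) = MvPowerSeries.coeff m f :=
  eAux_inj.extend_apply _ _ _

lemma phiFun_coeff' (f : MvPowerSeries (Fin 2) F) {g} (h : g ∉ Set.range eAux) :
    (phiFun f).coeff g = 0 :=
  Function.extend_apply' _ _ _ h

lemma phiFun_inj : Function.Injective (phiFun (F := F)) := by
  intro a b h
  ext m
  rw [← phiFun_coeff, h, phiFun_coeff]

lemma phiFun_surj (u : HahnSeries (ℤ ×ₗ ℤ) F) (h : u.support ⊆ Set.range eAux) :
    ∃ f, phiFun f = u := by
  refine ⟨(show MvPowerSeries (Fin 2) F from fun m => u.coeff (eAux m)), ?_⟩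
  ext g
  by_cases hg : g ∈ Set.range eAux
  · obtain ⟨m, rfl⟩ := hg
    rw [phiFun_coeff]; rfl
  · rw [phiFun_coeff' _ hg]
    by_contra hne
    exact hg (h (Ne.symm hne))

lemma phiFun_mul (a b : MvPowerSeries (Fin 2) F) : phiFun (a * b) = phiFun a * phiFun b := by
  classical
  have hsup : ∀ (f : MvPowerSeries (Fin 2) F) g, (phiFun f).coeff g ≠ 0 → ∃ m, eAux m = g := by
    intro f g h
    by_contra h'
    exact h (phiFun_coeff' f h')
  ext g
  rw [HahnSeries.coeff_mul]
  by_cases hg : g ∈ Set.range eAux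
  · obtain ⟨m, rfl⟩ := hg
    rw [phiFun_coeff, MvPowerSeries.coeff_mul]
    symm
    have : ∑ p ∈ Finset.HasAntidiagonal.antidiagonal m, MvPowerSeries.coeff p.1 a * MvPowerSeries.coeff p.2 b
      = ∑ q ∈ (Finset.HasAntidiagonal.antidiagonal m).image (Prod.map eAux eAux),
          (phiFun a).coeff q.1 * (phiFun b).coeff q.2 := by
      rw [Finset.sum_image]
      · simp [phiFun_coeff]
      · exact (eAux_inj.prodMap eAux_inj).injOn
    rw [this]
    apply Finset.sum_subset
    · rintro ⟨i, j⟩ hij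
      simp only [Finset.mem_antidiagonal, HahnSeries.mem_support] at hij
      obtain ⟨hi, hj, hs⟩ := hij
      obtain ⟨x, rfl⟩ := hsup _ _ hi
      obtain ⟨y, rfl⟩ := hsup _ _ hj
      rw [Finset.mem_image]
      refine ⟨(x, y), ?_, rfl⟩
      rw [Finset.HasAntidiagonal.mem_antidiagonal]
      apply eAux_inj
      rw [map_add]; exact hs
    · rintro ⟨i, j⟩ hij hn
      rw [Finset.mem_image] at hij
      obtain ⟨⟨x, y⟩, hxy, he⟩ := hij
      rw [Finset.HasAntidiagonal.mem_antidiagonal] at hxy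
      by_contra hne
      apply hn
      simp only [Finset.mem_antidiagonal, HahnSeries.mem_support]
      refine ⟨left_ne_zero_of_mul hne, right_ne_zero_of_mul hne, ?_⟩
      simp only [Prod.map, Prod.mk.injEq] at he
      rw [← he.1, ← he.2, ← map_add, hxy]
  · rw [phiFun_coeff' _ hg]
    symm
    apply Finset.sum_eq_zero
    rintro ⟨i, j⟩ hij
    exfalso
    simp only [Finset.mem_antidiagonal, HahnSeries.mem_support] at hij
    obtain ⟨hi, hj, hs⟩ := hij
    obtain ⟨x, rfl⟩ := hsup _ _ hi
    obtain ⟨y, rfl⟩ := hsup _ _ hj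
    exact hg ⟨x + y, by rw [map_add]; exact hs⟩

/-- the embedding as a ring hom -/
def phiHom : MvPowerSeries (Fin 2) F →+* HahnSeries (ℤ ×ₗ ℤ) F where
  toFun := phiFun
  map_mul' := phiFun_mul
  map_one' := by
    have h1 : phiFun (1 : MvPowerSeries (Fin 2) F) ≠ 0 := by
      intro h
      have := phiFun_coeff (1 : MvPowerSeries (Fin 2) F) 0
      rw [h] at this
      simp at this
    have := phiFun_mul (1 : MvPowerSeries (Fin 2) F) 1
    rw [one_mul] at this
    exact (mul_eq_left₀ h1).mp this.symm
  map_zero' := by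
    ext g
    by_cases hg : g ∈ Set.range eAux
    · obtain ⟨m, rfl⟩ := hg
      simp [phiFun_coeff]
    · simp [phiFun_coeff' _ hg]
  map_add' a b := by
    ext g
    by_cases hg : g ∈ Set.range eAux
    · obtain ⟨m, rfl⟩ := hg
      simp [phiFun_coeff]
    · simp [phiFun_coeff' _ hg]

lemma range_of_mul_bounded (d s : ℤ) (h : ∀ n : ℕ, 0 ≤ d + n * s) : 0 ≤ s := by
  by_contra hs
  push Not at hs
  have := h (d.toNat + 1)
  push_cast at this
  have h2 : d ≤ d.toNat := Int.self_le_toNat d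
  nlinarith

/-- `F[[Y,Z]]` is completely integrally closed. -/
lemma cic (d f g : MvPowerSeries (Fin 2) F) (hd : d ≠ 0) (hg : g ≠ 0)
    (h : ∀ n : ℕ, g ^ n ∣ d * f ^ n) : g ∣ f := by
  classical
  let _ : Algebra (MvPowerSeries (Fin 2) F) (HahnSeries (ℤ ×ₗ ℤ) F) := phiHom.toAlgebra
  have halg : ∀ x, algebraMap (MvPowerSeries (Fin 2) F) (HahnSeries (ℤ ×ₗ ℤ) F) x = phiFun x :=
    fun x => rfl
  have hinj : Function.Injective (phiHom (F := F)) := phiFun_inj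
  set u : HahnSeries (ℤ ×ₗ ℤ) F := phiHom f / phiHom g with hu
  have hg' : phiHom g ≠ 0 := (map_ne_zero_iff _ hinj).mpr hg
  have key : u ∈ completeIntegralClosure (MvPowerSeries (Fin 2) F) (HahnSeries (ℤ ×ₗ ℤ) F) := by
    refine ⟨d, mem_nonZeroDivisors_of_ne_zero hd, fun n => ?_⟩
    obtain ⟨c, hc⟩ := h n
    refine ⟨c, ?_⟩
    rw [Algebra.smul_def]
    change phiHom c = phiHom d * _
    rw [hu, div_pow, ← mul_div_assoc, eq_div_iff (pow_ne_zero _ hg'), ← map_pow, ← map_pow,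
      ← map_mul, ← map_mul, hc, mul_comm]
  have hsup : u.support ⊆ Set.range eAux := by
    by_contra hns
    have hne : (u.support \ Set.range eAux).Nonempty := Set.sdiff_nonempty.mpr hns
    have hwf : (u.support \ Set.range eAux).IsWF := u.isWF_support.mono Set.sdiff_subset
    set s := hwf.min hne with hs
    have hsmem := hwf.min_mem hne
    rw [← hs] at hsmem
    obtain ⟨t, ht⟩ := phiFun_surj (truncLT s u) (by
      intro g hg
      rw [support_truncLT] at hg
      by_contra hgn
      exact hwf.not_lt_min hne ⟨hg.1, hgn⟩ hg.2)
    set u' := u - truncLT s u with hu'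
    have key' : u' ∈ completeIntegralClosure (MvPowerSeries (Fin 2) F)
        (HahnSeries (ℤ ×ₗ ℤ) F) := by
      apply sub_mem key
      rw [← ht, ← halg]
      exact Subalgebra.algebraMap_mem _ _
    have hcs : u'.coeff s ≠ 0 := by
      rw [hu', coeff_sub, coeff_truncLT_of_le le_rfl, sub_zero]
      exact hsmem.1
    have hu0 : u' ≠ 0 := by
      intro h0
      rw [h0] at hcs
      simp at hcs
    have hord : u'.order = s := by
      apply le_antisymm (order_le_of_coeff_ne_zero hcs)
      rw [le_order_iff_forall hu0]
      intro j hj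
      rw [hu', coeff_sub, coeff_truncLT_of_lt hj, sub_self]
    obtain ⟨r, hr, hrn⟩ := key'
    have hr0 : phiHom r ≠ 0 := (map_ne_zero_iff _ hinj).mpr (nonZeroDivisors.ne_zero hr)
    have hb : ∀ n : ℕ, (phiHom r).order + n • s ∈ Set.range eAux := by
      intro n
      obtain ⟨c, hc⟩ := hrn n
      rw [Algebra.smul_def] at hc
      change phiHom c = phiHom r * _ at hc
      have h1 : (phiHom c).order = (phiHom r).order + n • s := by
        rw [hc, order_mul hr0 (pow_ne_zero _ hu0), order_pow, hord]
      rw [← h1]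
      by_contra hnot
      have h2 : (phiHom c).coeff (phiHom c).order = 0 := phiFun_coeff' c hnot
      rw [coeff_order_eq_zero, hc] at h2
      exact mul_ne_zero hr0 (pow_ne_zero _ hu0) h2
    apply hsmem.2
    apply eAux_range
    · apply range_of_mul_bounded (ofLex (phiHom r).order).1
      intro n
      obtain ⟨m, hm⟩ := hb n
      have := congrArg (fun x => (ofLex x).1) hm
      simp only [eAux_fst, eAux_snd] at this
      have h3 : (0 : ℤ) ≤ (m 0 : ℤ) ∧ (0 : ℤ) ≤ (m 1 : ℤ) := ⟨Int.natCast_nonneg _, Int.natCast_nonneg _⟩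
      simp at this
      omega
    · apply range_of_mul_bounded (ofLex (phiHom r).order).2
      intro n
      obtain ⟨m, hm⟩ := hb n
      have := congrArg (fun x => (ofLex x).2) hm
      simp only [eAux_fst, eAux_snd] at this
      have h3 : (0 : ℤ) ≤ (m 0 : ℤ) ∧ (0 : ℤ) ≤ (m 1 : ℤ) := ⟨Int.natCast_nonneg _, Int.natCast_nonneg _⟩
      simp at this
      omega
  obtain ⟨q, hq⟩ := phiFun_surj u hsup
  refine ⟨q, hinj ?_⟩
  rw [map_mul]
  change _ = _ * phiFun q
  rw [hq, hu, mul_div_cancel₀ _ hg']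

end HahnPart

section MainPart

/-- the inclusion of `T` in `K` -/
abbrev tau : Tk k →+* FieldK k := algebraMap (Tk k) (FieldK k)

lemma tau_inj : Function.Injective (tau k) := IsFractionRing.injective (Tk k) (FieldK k)

lemma algMap_eq (r : subR k) : algebraMap (subR k) (FieldK k) r = tau k r.1 := rfl

lemma mem_oneR {x : FieldK k} :
    x ∈ (1 : Submodule (subR k) (FieldK k)) ↔ ∃ t ∈ subR k, tau k t = x := by
  rw [Submodule.mem_one]
  constructor
  · rintro ⟨r, rfl⟩
    exact ⟨r.1, r.2, rfl⟩
  · rintro ⟨t, ht, rfl⟩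
    exact ⟨⟨t, ht⟩, rfl⟩

lemma tau_mem_one {t : Tk k} : tau k t ∈ (1 : Submodule (subR k) (FieldK k)) ↔ t ∈ subR k := by
  rw [mem_oneR]
  constructor
  · rintro ⟨s, hs, h⟩
    rwa [← tau_inj k h]
  · intro h
    exact ⟨t, h, rfl⟩

lemma mul_mem_one {x y : FieldK k} (hx : x ∈ (1 : Submodule (subR k) (FieldK k)))
    (hy : y ∈ (1 : Submodule (subR k) (FieldK k))) :
    x * y ∈ (1 : Submodule (subR k) (FieldK k)) := by
  have := Submodule.mul_mem_mul hx hy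
  rwa [one_mul] at this

lemma mem_subR {t : Tk k} :
    t ∈ subR k ↔ ∃ v, algebraMap (PowerSeries k) (LaurentSeries k) v
      = MvPowerSeries.constantCoeff t := Iff.rfl

lemma mem_subR_of_zero {t : Tk k} (h : MvPowerSeries.constantCoeff t = 0) : t ∈ subR k := by
  rw [mem_subR]
  exact ⟨0, by rw [h, map_zero]⟩

lemma mem_idl {I : Ideal (subR k)} {x : FieldK k} :
    x ∈ idl k I ↔ ∃ r ∈ I, tau k r.1 = x := Iff.rfl

lemma mem_dual {A : Submodule (subR k) (FieldK k)} {x : FieldK k} :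
    x ∈ (1 : Submodule (subR k) (FieldK k)) / A ↔
      ∀ y ∈ A, x * y ∈ (1 : Submodule (subR k) (FieldK k)) :=
  Submodule.mem_div_iff_forall_mul_mem

lemma mem_dual_idl {A : Ideal (subR k)} {x : FieldK k} :
    x ∈ (1 : Submodule (subR k) (FieldK k)) / idl k A ↔
      ∀ a ∈ A, x * tau k a.1 ∈ (1 : Submodule (subR k) (FieldK k)) := by
  rw [mem_dual]
  constructor
  · intro h a ha
    exact h _ ⟨a, ha, rfl⟩
  · rintro h _ ⟨a, ha, rfl⟩
    exact h a ha

lemma dual_anti {A B : Submodule (subR k) (FieldK k)} (h : A ≤ B) :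
    (1 : Submodule (subR k) (FieldK k)) / B ≤ 1 / A := by
  intro x hx
  rw [mem_dual] at hx ⊢
  exact fun y hy => hx y (h hy)

lemma le_vSub (A : Submodule (subR k) (FieldK k)) : A ≤ vSub k A := by
  intro x hx
  rw [vSub, mem_dual]
  intro y hy
  rw [mul_comm]
  exact (mem_dual k).1 hy x hx

lemma dual_vSub (A : Submodule (subR k) (FieldK k)) :
    (1 : Submodule (subR k) (FieldK k)) / vSub k A = 1 / A := by
  apply le_antisymm
  · exact dual_anti k (le_vSub k A)
  · intro x hx
    rw [mem_dual]
    intro y hy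
    rw [mul_comm]
    exact (mem_dual k).1 hy x hx

lemma mem_dual_mul {A B : Ideal (subR k)} {x : FieldK k} :
    x ∈ (1 : Submodule (subR k) (FieldK k)) / idl k (A * B) ↔
      ∀ a ∈ A, ∀ b ∈ B, x * (tau k a.1 * tau k b.1) ∈ (1 : Submodule (subR k) (FieldK k)) := by
  rw [mem_dual_idl]
  constructor
  · intro h a ha b hb
    have := h (a * b) (Ideal.mul_mem_mul ha hb)
    rwa [Subring.coe_mul, map_mul] at this
  · intro h c hc
    refine Submodule.mul_induction_on hc ?_ ?_
    · intro a ha b hb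
      have := h a ha b hb
      rwa [Subring.coe_mul, map_mul]
    · intro a b ha hb
      rw [Subring.coe_add, map_add, mul_add]
      exact add_mem ha hb

lemma exists_max_V {ι : Type*} (s : Finset ι) (hs : s.Nonempty) (c : ι → LaurentSeries k) :
    ∃ i ∈ s, ∀ j ∈ s, ∃ v, algebraMap (PowerSeries k) (LaurentSeries k) v * c i = c j := by
  obtain ⟨i, hi, hmax⟩ := Finset.exists_max_image s
    (fun i => ValuationRing.valuation (PowerSeries k) (LaurentSeries k) (c i)) hs
  refine ⟨i, hi, fun j hj => ?_⟩
  by_cases h0 : c i = 0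
  · have := hmax j hj
    rw [h0, map_zero, le_zero_iff, map_eq_zero] at this
    exact ⟨0, by rw [this, h0, mul_zero]⟩
  · have h1 : c j / c i ∈ (ValuationRing.valuation (PowerSeries k) (LaurentSeries k)).integer := by
      rw [Valuation.mem_integer_iff, map_div₀]
      exact div_le_one_of_le₀ (hmax j hj) (zero_le)
    rw [ValuationRing.mem_integer_iff] at h1
    obtain ⟨v, hv⟩ := h1
    exact ⟨v, by rw [hv, div_mul_cancel₀ _ h0]⟩

/-- The case where `I T` is principal. -/
lemma principal_of_unit (I : Ideal (subR k)) (hfg : I.FG) (t : FieldK k)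
    (ht : ∀ a ∈ I, ∃ b, tau k b = t * tau k a.1)
    (hu : ∃ a ∈ I, ∃ b, tau k b = t * tau k a.1 ∧ MvPowerSeries.constantCoeff b ≠ 0) :
    ∃ s ∈ I, s ≠ 0 ∧ ∀ a ∈ I, ∃ r, a = r * s := by
  classical
  obtain ⟨S, rfl⟩ := hfg
  choose! β hβ using ht
  have hβ' : ∀ a ∈ S, tau k (β a) = t * tau k a.1 := fun a ha => hβ a (Ideal.subset_span ha)
  have hne : S.Nonempty := by
    by_contra hS
    rw [Finset.not_nonempty_iff_eq_empty] at hS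
    subst hS
    obtain ⟨a, ha, b, hb, hb0⟩ := hu
    have ha0 : a = 0 := by simpa using ha
    subst ha0
    rw [Subring.coe_zero, map_zero, mul_zero] at hb
    have : b = 0 := tau_inj k (by rw [hb, map_zero])
    subst this
    exact hb0 (map_zero _)
  obtain ⟨s, hs, hmax⟩ := exists_max_V k S hne (fun a => MvPowerSeries.constantCoeff (β a))
  -- the constant coefficient of `β s` is nonzero
  have hs0 : MvPowerSeries.constantCoeff (β s) ≠ 0 := by
    intro h0
    have hall : ∀ a ∈ Ideal.span (S : Set (subR k)), ∃ b, tau k b = t * tau k a.1 ∧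
        MvPowerSeries.constantCoeff b = 0 := by
      intro a ha
      refine Submodule.span_induction ?_ ?_ ?_ ?_ ha
      · intro x hx
        refine ⟨β x, hβ' x hx, ?_⟩
        obtain ⟨v, hv⟩ := hmax x hx
        rw [← hv, h0, mul_zero]
      · exact ⟨0, by simp, map_zero _⟩
      · rintro x y - - ⟨b, hb, hb0⟩ ⟨c, hc, hc0⟩
        exact ⟨b + c, by rw [map_add, hb, hc, Subring.coe_add, map_add, mul_add],
          by rw [map_add, hb0, hc0, add_zero]⟩
      · rintro r x - ⟨b, hb, hb0⟩
        exact ⟨r.1 * b, by rw [map_mul, hb, smul_eq_mul, Subring.coe_mul, map_mul]; ring,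
          by rw [map_mul, hb0, mul_zero]⟩
    obtain ⟨a, ha, b, hb, hb0⟩ := hu
    obtain ⟨c, hc, hc0⟩ := hall a ha
    have : b = c := tau_inj k (by rw [hb, hc])
    exact hb0 (this ▸ hc0)
  have hunit : IsUnit (β s) := by
    rw [MvPowerSeries.isUnit_iff_constantCoeff]
    exact hs0.isUnit
  have hβs : tau k (β s) ≠ 0 := by
    rw [Ne, map_eq_zero_iff _ (tau_inj k)]
    exact hunit.ne_zero
  have ht0 : t ≠ 0 := by
    rintro rfl
    rw [hβ' s hs, zero_mul] at hβs
    exact hβs rfl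
  refine ⟨s, Ideal.subset_span hs, ?_, ?_⟩
  · rintro rfl
    rw [hβ' _ hs] at hβs
    simp at hβs
  have hle : Ideal.span (S : Set (subR k)) ≤ Ideal.span {s} := by
    rw [Ideal.span_le]
    intro x hx
    rw [SetLike.mem_coe, Ideal.mem_span_singleton']
    obtain ⟨q, hq⟩ := hunit.dvd (a := β x)
    obtain ⟨v, hv⟩ := hmax x hx
    have hqR : q ∈ subR k := by
      rw [mem_subR]
      refine ⟨v, ?_⟩
      rw [hq, map_mul, mul_comm] at hv
      exact mul_left_cancel₀ hs0 hv
    refine ⟨⟨q, hqR⟩, ?_⟩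
    apply Subtype.ext
    apply tau_inj k
    apply mul_left_cancel₀ ht0
    rw [← hβ' x hx, hq, map_mul, hβ' s hs, Subring.coe_mul, map_mul]
    ring
  intro a ha
  obtain ⟨r, hr⟩ := Ideal.mem_span_singleton'.mp (hle ha)
  exact ⟨r, hr.symm⟩

lemma basic_part (I : Ideal (subR k)) (hfg : I.FG) (J : Ideal (subR k)) (hJI : J ≤ I) (n : ℕ)
    (h : vSub k (idl k (J * I ^ n)) = vSub k (idl k (I ^ (n + 1)))) :
    vSub k (idl k J) = vSub k (idl k I) := by
  have hd : (1 : Submodule (subR k) (FieldK k)) / idl k (J * I ^ n)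
      = 1 / idl k (I * I ^ n) := by
    rw [← dual_vSub, h, dual_vSub, pow_succ']
  suffices hJ : (1 : Submodule (subR k) (FieldK k)) / idl k J = 1 / idl k I by
    rw [vSub, vSub, hJ]
  apply le_antisymm
  swap
  · exact dual_anti k (Submodule.map_mono hJI)
  intro u hu
  rw [mem_dual_idl] at hu
  by_cases hP : ∃ t : FieldK k, (∀ a ∈ I, ∃ b, tau k b = t * tau k a.1) ∧
    (∃ a ∈ I, ∃ b, tau k b = t * tau k a.1 ∧ MvPowerSeries.constantCoeff b ≠ 0)
  · obtain ⟨t, ht, htu⟩ := hP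
    obtain ⟨s, hsI, hs0, hs⟩ := principal_of_unit k I hfg t ht htu
    have hτ : tau k s.1 ≠ 0 := by
      rw [Ne, map_eq_zero_iff _ (tau_inj k)]
      exact fun h0 => hs0 (Subtype.ext h0)
    have hspan : I = Ideal.span {s} := by
      apply le_antisymm
      · intro a ha
        rw [Ideal.mem_span_singleton']
        obtain ⟨r, hr⟩ := hs a ha
        exact ⟨r, hr.symm⟩
      · rw [Ideal.span_le]
        simpa using hsI
    have h1 : u / tau k s.1 ^ n ∈ (1 : Submodule (subR k) (FieldK k)) / idl k (J * I ^ n) := by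
      rw [mem_dual_mul]
      intro a ha b hb
      rw [hspan, Ideal.span_singleton_pow, Ideal.mem_span_singleton'] at hb
      obtain ⟨r, rfl⟩ := hb
      have e : u / tau k s.1 ^ n * (tau k a.1 * tau k (r * s ^ n : subR k).1)
          = (u * tau k a.1) * tau k r.1 := by
        rw [Subring.coe_mul, Subring.coe_pow, map_mul, map_pow]
        field_simp
      rw [e]
      exact mul_mem_one k (hu a ha) ((tau_mem_one k).2 r.2)
    rw [hd, mem_dual_mul] at h1
    have h2 := h1 s hsI (s ^ n) (Ideal.pow_mem_pow hsI n)
    have e : u / tau k s.1 ^ n * (tau k s.1 * tau k (s ^ n : subR k).1) = u * tau k s.1 := by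
      rw [Subring.coe_pow, map_pow]
      field_simp
    rw [e] at h2
    rw [mem_dual_idl]
    intro a ha
    obtain ⟨r, rfl⟩ := hs a ha
    rw [Subring.coe_mul, map_mul, mul_left_comm]
    exact mul_mem_one k ((tau_mem_one k).2 r.2) h2
  · push Not at hP
    have claim : ∀ a ∈ I, ∃ b, tau k b = u * tau k a.1 := by
      intro i hi
      by_cases hi0 : i = 0
      · subst hi0
        exact ⟨0, by simp⟩
      have hτ : i.1 ≠ 0 := fun h0 => hi0 (Subtype.ext h0)
      have hC : ∀ c ∈ (1 : Submodule (subR k) (FieldK k)) / idl k (I ^ n),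
          (u * tau k i.1) * c ∈ (1 : Submodule (subR k) (FieldK k)) / idl k (I ^ n) := by
        intro c hc
        rw [mem_dual_idl] at hc
        have h1 : u * c ∈ (1 : Submodule (subR k) (FieldK k)) / idl k (J * I ^ n) := by
          rw [mem_dual_mul]
          intro a ha b hb
          rw [mul_mul_mul_comm]
          exact mul_mem_one k (hu a ha) (hc b hb)
        rw [hd, mem_dual_mul] at h1
        rw [mem_dual_idl]
        intro b hb
        have := h1 i hi b hb
        convert this using 1
        ring
      have hpow : ∀ m : ℕ, (u * tau k i.1) ^ m ∈
          (1 : Submodule (subR k) (FieldK k)) / idl k (I ^ n) := by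
        intro m
        induction m with
        | zero =>
          rw [pow_zero, mem_dual_idl]
          intro a _
          rw [one_mul]
          exact (tau_mem_one k).2 a.2
        | succ m ih =>
          rw [pow_succ']
          exact hC _ ih
      obtain ⟨f, g, hg, hfg'⟩ := IsFractionRing.div_surjective (A := Tk k) (u * tau k i.1)
      have hg0 : g ≠ 0 := nonZeroDivisors.ne_zero hg
      have hτg : tau k g ≠ 0 := by
        rwa [Ne, map_eq_zero_iff _ (tau_inj k)]
      have hdvd : g ∣ f := by
        apply cic (i.1 ^ n) f g (pow_ne_zero _ hτ) hg0
        intro m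
        have := (mem_dual_idl k).1 (hpow m) (i ^ n) (Ideal.pow_mem_pow hi n)
        obtain ⟨q, -, hq⟩ := (mem_oneR k).1 this
        refine ⟨q, tau_inj k ?_⟩
        rw [map_mul, map_mul, hq, ← hfg', div_pow, Subring.coe_pow, map_pow, map_pow, map_pow]
        change _ = tau k g ^ m * (tau k f ^ m / tau k g ^ m * _)
        field_simp
      obtain ⟨q, rfl⟩ := hdvd
      refine ⟨q, ?_⟩
      rw [← hfg', map_mul]
      change _ = tau k g * tau k q / tau k g
      field_simp
    have hz := hP u claim
    rw [mem_dual_idl]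
    intro a ha
    obtain ⟨b, hb⟩ := claim a ha
    rw [← hb, tau_mem_one]
    exact mem_subR_of_zero k (hz a ha b hb)

lemma X_dvd_of (f g : Tk k) (h : MvPowerSeries.X 1 * f = MvPowerSeries.X 0 * g) :
    (MvPowerSeries.X 0 : Tk k) ∣ f := by
  rw [MvPowerSeries.X_dvd_iff]
  intro m hm
  have h1 : MvPowerSeries.coeff (Finsupp.single 1 1 + m) (MvPowerSeries.X 1 * f) =
      MvPowerSeries.coeff m f := by
    rw [MvPowerSeries.X, MvPowerSeries.coeff_add_monomial_mul, one_mul]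
  rw [← h1, h]
  apply (MvPowerSeries.X_dvd_iff).1 (dvd_mul_right _ _)
  simp [hm]

/-- Anything multiplying `Y` and `Z` into `R` lies in `T`. -/
lemma mem_T_of (u : FieldK k) (hy : u * tau k (yR k).1 ∈ (1 : Submodule (subR k) (FieldK k)))
    (hz : u * tau k (zR k).1 ∈ (1 : Submodule (subR k) (FieldK k))) : ∃ t, tau k t = u := by
  obtain ⟨f, -, hf⟩ := (mem_oneR k).1 hy
  obtain ⟨g, -, hg⟩ := (mem_oneR k).1 hz
  have hyT : (yR k).1 = MvPowerSeries.X 0 := rfl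
  have hzT : (zR k).1 = MvPowerSeries.X 1 := rfl
  have hy0 : tau k (yR k).1 ≠ 0 := by
    rw [Ne, map_eq_zero_iff _ (tau_inj k), hyT]
    intro h0
    have h1 := congrArg (MvPowerSeries.coeff (Finsupp.single 0 1)) h0
    rw [MvPowerSeries.coeff_index_single_self_X, map_zero] at h1
    exact one_ne_zero h1
  have h : (MvPowerSeries.X 1 : Tk k) * f = MvPowerSeries.X 0 * g := by
    apply tau_inj k
    rw [map_mul, map_mul, hf, hg, ← hyT, ← hzT]
    ring
  obtain ⟨q, rfl⟩ := X_dvd_of k f g h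
  refine ⟨q, ?_⟩
  rw [map_mul, ← hyT, mul_comm] at hf
  exact mul_right_cancel₀ hy0 hf

lemma cc_of_mem_span {a : subR k} (ha : a ∈ Ideal.span {yR k, zR k}) :
    MvPowerSeries.constantCoeff a.1 = 0 := by
  obtain ⟨x, y, rfl⟩ := Ideal.mem_span_pair.1 ha
  have hyT : (yR k).1 = MvPowerSeries.X 0 := rfl
  have hzT : (zR k).1 = MvPowerSeries.X 1 := rfl
  rw [Subring.coe_add, Subring.coe_mul, Subring.coe_mul, hyT, hzT]
  simp

lemma dual_YZ (u : FieldK k) :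
    u ∈ (1 : Submodule (subR k) (FieldK k)) / idl k (Ideal.span {yR k, zR k}) ↔
      ∃ t, tau k t = u := by
  rw [mem_dual_idl]
  constructor
  · intro h
    exact mem_T_of k u (h _ (Ideal.subset_span (by simp))) (h _ (Ideal.subset_span (by simp)))
  · rintro ⟨t, rfl⟩ a ha
    rw [← map_mul, tau_mem_one]
    apply mem_subR_of_zero
    rw [map_mul, cc_of_mem_span k ha, mul_zero]

lemma dual_prod (u : FieldK k) :
    u ∈ (1 : Submodule (subR k) (FieldK k)) / (idl k (Ideal.span {yR k, zR k}) *
      ((1 : Submodule (subR k) (FieldK k)) / idl k (Ideal.span {yR k, zR k}))) ↔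
      ∃ t, tau k t = u := by
  constructor
  · intro h
    rw [← dual_YZ]
    rw [mem_dual] at h ⊢
    intro y hy
    apply h
    have h1 : (1 : FieldK k) ∈
        ((1 : Submodule (subR k) (FieldK k)) / idl k (Ideal.span {yR k, zR k})) := by
      rw [dual_YZ]
      exact ⟨1, map_one _⟩
    have := Submodule.mul_mem_mul hy h1
    rwa [mul_one] at this
  · rintro ⟨t, rfl⟩
    rw [mem_dual]
    intro y hy
    refine Submodule.mul_induction_on hy ?_ ?_
    · rintro _ ⟨a, ha, rfl⟩ b hb
      obtain ⟨s, rfl⟩ := (dual_YZ k b).1 hb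
      change tau k t * (tau k a.1 * tau k s) ∈ _
      rw [← map_mul, ← map_mul, tau_mem_one]
      apply mem_subR_of_zero
      rw [map_mul, map_mul, cc_of_mem_span k ha, zero_mul, mul_zero]
    · intro a b ha hb
      rw [mul_add]
      exact add_mem ha hb

lemma mem_idealMR {r : subR k} : r ∈ idealMR k ↔ MvPowerSeries.constantCoeff r.1 = 0 := Iff.rfl

lemma v_prod : vSub k (idl k (Ideal.span {yR k, zR k})
            * ((1 : Submodule (subR k) (FieldK k)) / idl k (Ideal.span {yR k, zR k})))
          = idl k (idealMR k) := by
  ext u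
  rw [vSub, mem_dual, mem_idl]
  constructor
  · intro h
    have h1 := h 1 ((dual_prod k 1).2 ⟨1, map_one _⟩)
    rw [mul_one] at h1
    obtain ⟨r, hr, rfl⟩ := (mem_oneR k).1 h1
    refine ⟨⟨r, hr⟩, ?_, rfl⟩
    rw [mem_idealMR]
    by_contra hc
    set c := MvPowerSeries.constantCoeff r with hcdef
    set x : LaurentSeries k := algebraMap (PowerSeries k) (LaurentSeries k) PowerSeries.X with hx
    have hinj : Function.Injective (algebraMap (PowerSeries k) (LaurentSeries k)) :=
      IsFractionRing.injective _ _
    have hx0 : x ≠ 0 := by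
      rw [hx, Ne, map_eq_zero_iff _ hinj]
      exact PowerSeries.X_ne_zero
    have h2 := h (tau k (MvPowerSeries.C (c⁻¹ * x⁻¹))) ((dual_prod k _).2 ⟨_, rfl⟩)
    rw [← map_mul, tau_mem_one, mem_subR] at h2
    obtain ⟨v, hv⟩ := h2
    rw [map_mul, MvPowerSeries.constantCoeff_C, ← hcdef, mul_inv_cancel_left₀ hc] at hv
    have h3 : algebraMap (PowerSeries k) (LaurentSeries k) (v * PowerSeries.X) =
        algebraMap (PowerSeries k) (LaurentSeries k) 1 := by
      rw [map_mul, hv, ← hx, inv_mul_cancel₀ hx0, map_one]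
    have h4 := congrArg PowerSeries.constantCoeff (hinj h3)
    simp at h4
  · rintro ⟨r, hr, rfl⟩ y hy
    obtain ⟨t, rfl⟩ := (dual_prod k y).1 hy
    rw [← map_mul, tau_mem_one]
    apply mem_subR_of_zero
    rw [map_mul, (mem_idealMR k).1 hr, zero_mul]

lemma M_ne : idl k (idealMR k) ≠ (1 : Submodule (subR k) (FieldK k)) := by
  intro h
  have h1 : (1 : FieldK k) ∈ idl k (idealMR k) := by
    rw [h]
    exact (mem_oneR k).2 ⟨1, one_mem _, map_one _⟩
  obtain ⟨r, hr, h2⟩ := (mem_idl k).1 h1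
  have : r.1 = 1 := tau_inj k (by rw [h2, map_one])
  rw [mem_idealMR, this, map_one] at hr
  exact one_ne_zero hr

end MainPart

/-- Let `T = k((X))[[Y,Z]]`, `M = (Y,Z)T` and `R = k[[X]] + M`.  Then `R` has the finite
`v`-basic ideal property (every nonzero finitely generated ideal of `R` is `v`-basic), but
`R` is not a `v`-domain: the finitely generated ideal `(Y,Z)R` satisfies
`((Y,Z)R · ((Y,Z)R)⁻¹)_v = M ≠ R`. -/
theorem finite_v_basic_not_v_domain :
    (∀ I : Ideal (subR k), I ≠ ⊥ → I.FG →
        ∀ J : Ideal (subR k), J ≠ ⊥ → J ≤ I →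
          (∃ n : ℕ, vSub k (idl k (J * I ^ n)) = vSub k (idl k (I ^ (n + 1)))) →
          vSub k (idl k J) = vSub k (idl k I))
      ∧ vSub k (idl k (Ideal.span {yR k, zR k})
            * ((1 : Submodule (subR k) (FieldK k)) / idl k (Ideal.span {yR k, zR k})))
          = idl k (idealMR k)
      ∧ idl k (idealMR k) ≠ (1 : Submodule (subR k) (FieldK k)) := by
  exact ⟨fun I _ hfg J _ hJI ⟨n, hn⟩ => basic_part k I hfg J hJI n hn, v_prod k, M_ne k⟩

end
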